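/- arXiv:math-ph/0611040 — 3 statements merged into one kernel-verified Lean document; each statement's English description precedes it below -/
import Mathlib

section
/- (Theorem 2) Let N ≥ 2, let z ≠ 0 and b_1,…,b_N be real parameters, and let 𝓗 : ℝ³ → ℝ be any smooth function. On the open subset of ℝ^{2N} where every q_i ≠ 0, with K_i^{(N)} = −Σ_{k=1}^{i−1} q_k² + Σ_{l=i+1}^{N} q_l², define the Hamiltonian H_z = 𝓗( Σ_i q_i², Σ_i ((sinh(z q_i²)/(z q_i²)) p_i² + z b_i/sinh(z q_i²)) e^{z K_i^{(N)}}, Σ_i (sinh(z q_i²)/(z q_i²)) q_i p_i e^{z K_i^{(N)}} ). Then H_z Poisson-commutes with each of the 2N−3 deformed integrals C_z^{(m)} and C_{z,(m)}, 2 ≤ m ≤ N (where C_z^{(N)} = C_{z,(N)}), and each of the two sets of N functions {H_z, C_z^{(2)},…,C_z^{(N)}} and {H_z, C_{z,(2)},…,C_{z,(N)}} is in involution. -/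
open scoped BigOperators
open Real

noncomputable section

/-- Phase space ℝ^{2N} with canonical coordinates (q, p). -/
abbrev Phase (N : ℕ) : Type := (Fin N → ℝ) × (Fin N → ℝ)

/-- The canonical Poisson bracket
`{f,g} = ∑ i, (∂f/∂q_i · ∂g/∂p_i − ∂g/∂q_i · ∂f/∂p_i)`. -/
noncomputable def pb {N : ℕ} (f g : Phase N → ℝ) (x : Phase N) : ℝ :=
  ∑ i : Fin N,
    ((fderiv ℝ f x) (Pi.single i 1, 0) * (fderiv ℝ g x) (0, Pi.single i 1)
      - (fderiv ℝ g x) (Pi.single i 1, 0) * (fderiv ℝ f x) (0, Pi.single i 1))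

/-- `K_i^{(h)} = −Σ_{k=1}^{i−1} q_k² + Σ_{l=i+1}^{h} q_l²` (paper's 1-indexed
ranges; here indices are 0-indexed, so the second sum runs over `i < l < h`). -/
noncomputable def Kf (N : ℕ) (h : ℕ) (i : Fin N) (q : Fin N → ℝ) : ℝ :=
  ∑ k : Fin N, if (k : ℕ) < (i : ℕ) then -(q k) ^ 2
    else if (i : ℕ) < (k : ℕ) ∧ (k : ℕ) < h then (q k) ^ 2 else 0

/-- `K̃_i^{(h)} = −Σ_{k=h}^{i−1} q_k² + Σ_{l=i+1}^{N} q_l²` (paper's 1-indexed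
lower bound `h`; here `t = h − 1` is the 0-indexed lower bound). -/
noncomputable def Kt (N : ℕ) (t : ℕ) (i : Fin N) (q : Fin N → ℝ) : ℝ :=
  ∑ k : Fin N, if t ≤ (k : ℕ) ∧ (k : ℕ) < (i : ℕ) then -(q k) ^ 2
    else if (i : ℕ) < (k : ℕ) then (q k) ^ 2 else 0

/-- The deformed `J_-^{(N)} = Σ q_i²`. -/
noncomputable def Jmz (N : ℕ) : Phase N → ℝ := fun x => ∑ i : Fin N, (x.1 i) ^ 2

/-- The deformed
`J_+^{(N)} = Σ_i ((sinh(z q_i²)/(z q_i²)) p_i² + z b_i/sinh(z q_i²)) e^{z K_i^{(N)}}`. -/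
noncomputable def Jpz (N : ℕ) (z : ℝ) (b : Fin N → ℝ) : Phase N → ℝ :=
  fun x => ∑ i : Fin N,
    (Real.sinh (z * (x.1 i) ^ 2) / (z * (x.1 i) ^ 2) * (x.2 i) ^ 2
        + z * b i / Real.sinh (z * (x.1 i) ^ 2))
      * Real.exp (z * Kf N N i x.1)

/-- The deformed `J_3^{(N)} = Σ_i (sinh(z q_i²)/(z q_i²)) q_i p_i e^{z K_i^{(N)}}`. -/
noncomputable def J3z (N : ℕ) (z : ℝ) : Phase N → ℝ :=
  fun x => ∑ i : Fin N,
    Real.sinh (z * (x.1 i) ^ 2) / (z * (x.1 i) ^ 2) * (x.1 i * x.2 i)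
      * Real.exp (z * Kf N N i x.1)

/-- `Q_{ij}^z = (sinh(z q_i²)/(z q_i²))(sinh(z q_j²)/(z q_j²))(q_i p_j − q_j p_i)²
 + b_i sinh(z q_j²)/sinh(z q_i²) + b_j sinh(z q_i²)/sinh(z q_j²)`. -/
noncomputable def Qz (N : ℕ) (z : ℝ) (b : Fin N → ℝ) (i j : Fin N) (x : Phase N) : ℝ :=
  Real.sinh (z * (x.1 i) ^ 2) / (z * (x.1 i) ^ 2)
      * (Real.sinh (z * (x.1 j) ^ 2) / (z * (x.1 j) ^ 2))
      * (x.1 i * x.2 j - x.1 j * x.2 i) ^ 2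
    + b i * Real.sinh (z * (x.1 j) ^ 2) / Real.sinh (z * (x.1 i) ^ 2)
    + b j * Real.sinh (z * (x.1 i) ^ 2) / Real.sinh (z * (x.1 j) ^ 2)

/-- The deformed "left" integrals
`C_z^{(m)} = Σ_{i<j≤m} Q_{ij}^z e^{z(K_i^{(m)}+K_j^{(m)})} + Σ_{i≤m} b_i e^{2z K_i^{(m)}}`
(0-indexed: `i < j < m`). -/
noncomputable def Czleft (N : ℕ) (z : ℝ) (b : Fin N → ℝ) (m : ℕ) : Phase N → ℝ :=
  fun x =>
    (∑ i : Fin N, ∑ j : Fin N, if (i : ℕ) < (j : ℕ) ∧ (j : ℕ) < m then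
        Qz N z b i j x * Real.exp (z * (Kf N m i x.1 + Kf N m j x.1)) else 0)
    + ∑ i : Fin N, if (i : ℕ) < m then b i * Real.exp (2 * z * Kf N m i x.1) else 0

/-- The deformed "right" integrals
`C_{z,(m)} = Σ_{N−m+1≤i<j} Q_{ij}^z e^{z(K̃_i^{(N−m+1)}+K̃_j^{(N−m+1)})}
 + Σ_{N−m+1≤i} b_i e^{2z K̃_i^{(N−m+1)}}` (0-indexed: `N−m ≤ i < j`). -/
noncomputable def Czright (N : ℕ) (z : ℝ) (b : Fin N → ℝ) (m : ℕ) : Phase N → ℝ :=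
  fun x =>
    (∑ i : Fin N, ∑ j : Fin N, if N - m ≤ (i : ℕ) ∧ (i : ℕ) < (j : ℕ) then
        Qz N z b i j x * Real.exp (z * (Kt N (N - m) i x.1 + Kt N (N - m) j x.1)) else 0)
    + ∑ i : Fin N, if N - m ≤ (i : ℕ) then b i * Real.exp (2 * z * Kt N (N - m) i x.1) else 0

/-- The Poisson bivector as a bilinear form on covectors. -/
def poissonForm (N : ℕ) : (Phase N →L[ℝ] ℝ) →ₗ[ℝ] (Phase N →L[ℝ] ℝ) →ₗ[ℝ] ℝ :=
  LinearMap.mk₂ ℝ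
    (fun L M => ∑ i : Fin N, (L (Pi.single i 1, 0) * M (0, Pi.single i 1)
      - M (Pi.single i 1, 0) * L (0, Pi.single i 1)))
    (fun L L' M => by
      rw [← Finset.sum_add_distrib]
      exact Finset.sum_congr rfl fun i _ => by
        simp only [_root_.add_apply]; ring)
    (fun c L M => by
      rw [smul_eq_mul, Finset.mul_sum]
      exact Finset.sum_congr rfl fun i _ => by
        simp only [_root_.smul_apply, smul_eq_mul]; ring)
    (fun L M M' => by
      rw [← Finset.sum_add_distrib]
      exact Finset.sum_congr rfl fun i _ => by
        simp only [_root_.add_apply]; ring)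
    (fun c L M => by
      rw [smul_eq_mul, Finset.mul_sum]
      exact Finset.sum_congr rfl fun i _ => by
        simp only [_root_.smul_apply, smul_eq_mul]; ring)

lemma pb_eq_poissonForm {N : ℕ} (f g : Phase N → ℝ) (x : Phase N) :
    pb f g x = poissonForm N (fderiv ℝ f x) (fderiv ℝ g x) := rfl

lemma poissonForm_swap {N : ℕ} (L M : Phase N →L[ℝ] ℝ) :
    poissonForm N L M = -poissonForm N M L := by
  simp only [poissonForm, LinearMap.mk₂_apply, ← Finset.sum_neg_distrib]
  exact Finset.sum_congr rfl fun i _ => by ring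

lemma poissonForm_self {N : ℕ} (L : Phase N →L[ℝ] ℝ) : poissonForm N L L = 0 := by
  have h := poissonForm_swap L L
  linarith

lemma pb_swap {N : ℕ} (f g : Phase N → ℝ) (x : Phase N) : pb f g x = -pb g f x :=
  poissonForm_swap _ _

lemma pb_self {N : ℕ} (f : Phase N → ℝ) (x : Phase N) : pb f f x = 0 :=
  poissonForm_self _

open Filter Topology in
lemma pb_congr {N : ℕ} {f f' g g' : Phase N → ℝ} {x : Phase N}
    (hf : f =ᶠ[𝓝 x] f') (hg : g =ᶠ[𝓝 x] g') : pb f g x = pb f' g' x := by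
  rw [pb_eq_poissonForm, pb_eq_poissonForm, hf.fderiv_eq, hg.fderiv_eq]

/-- `f` is unchanged when the canonical coordinates with indices outside `S` vary. -/
def SupportedOn {N : ℕ} (S : Finset (Fin N)) (f : Phase N → ℝ) : Prop :=
  ∀ x y : Phase N, (∀ i ∈ S, x.1 i = y.1 i ∧ x.2 i = y.2 i) → f x = f y

lemma SupportedOn.fderiv_apply_eq_zero {N : ℕ} {S : Finset (Fin N)} {f : Phase N → ℝ}
    (hf : SupportedOn S f) {x : Phase N} (hd : DifferentiableAt ℝ f x) {v : Phase N}
    (hv : ∀ i ∈ S, v.1 i = 0 ∧ v.2 i = 0) : fderiv ℝ f x v = 0 := by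
  rw [← hd.lineDeriv_eq_fderiv, lineDeriv]
  have h : (fun t : ℝ => f (x + t • v)) = fun _ => f x := by
    funext t
    apply hf
    intro i hi
    simp [hv i hi]
  rw [h, deriv_const]

lemma pb_eq_zero_of_disjoint {N : ℕ} {S T : Finset (Fin N)} (hST : Disjoint S T)
    {f g : Phase N → ℝ} (hf : SupportedOn S f) (hg : SupportedOn T g) {x : Phase N}
    (hdf : DifferentiableAt ℝ f x) (hdg : DifferentiableAt ℝ g x) : pb f g x = 0 := by
  refine Finset.sum_eq_zero fun i _ => ?_
  have key : ∀ (U : Finset (Fin N)), i ∉ U → ∀ j ∈ U, (Pi.single i (1 : ℝ) : Fin N → ℝ) j = 0 :=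
    fun U hi j hj => Pi.single_eq_of_ne (by rintro rfl; exact hi hj) _
  by_cases hi : i ∈ S
  · have hi' : i ∉ T := Finset.disjoint_left.mp hST hi
    rw [hg.fderiv_apply_eq_zero hdg fun j hj => ⟨rfl, key T hi' j hj⟩,
      hg.fderiv_apply_eq_zero hdg fun j hj => ⟨key T hi' j hj, rfl⟩]
    ring
  · rw [hf.fderiv_apply_eq_zero hdf fun j hj => ⟨key S hi j hj, rfl⟩,
      hf.fderiv_apply_eq_zero hdf fun j hj => ⟨rfl, key S hi j hj⟩]
    ring

/-- At the point `x`, the functions `a`, `p`, `c` (in the roles of `J_-`, `J_+`, `J_3`) satisfy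
the Poisson relations of the non-standard deformation of `sl(2)` with parameter `z`. -/
structure IsDeformedSl2 {N : ℕ} (z : ℝ) (a p c : Phase N → ℝ) (x : Phase N) : Prop where
  diff_minus : DifferentiableAt ℝ a x
  diff_plus : DifferentiableAt ℝ p x
  diff_three : DifferentiableAt ℝ c x
  three_plus : pb c p x = 2 * p x * cosh (z * a x)
  three_minus : pb c a x = -2 * (sinh (z * a x) / z)
  minus_plus : pb a p x = 4 * c x

/-- The deformed coproduct of `J_+` and of `J_3`, where `a`, `a'` are the two copies of `J_-`. -/
def twistedSum {N : ℕ} (z : ℝ) (a a' f f' : Phase N → ℝ) : Phase N → ℝ :=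
  fun x => f x * exp (z * a' x) + exp (-(z * a x)) * f' x

lemma hasFDerivAt_twistedSum {N : ℕ} (z : ℝ) {a a' f f' : Phase N → ℝ} {x : Phase N}
    (ha : DifferentiableAt ℝ a x) (ha' : DifferentiableAt ℝ a' x)
    (hf : DifferentiableAt ℝ f x) (hf' : DifferentiableAt ℝ f' x) :
    HasFDerivAt (twistedSum z a a' f f')
      (exp (z * a' x) • fderiv ℝ f x + (f x * exp (z * a' x) * z) • fderiv ℝ a' x
        + (exp (-(z * a x)) • fderiv ℝ f' x
          + (-(f' x * exp (-(z * a x)) * z)) • fderiv ℝ a x)) x := by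
  have h := (hf.hasFDerivAt.mul (ha'.hasFDerivAt.const_mul z).exp).add
    ((ha.hasFDerivAt.const_mul z).neg.exp.mul hf'.hasFDerivAt)
  refine h.congr_fderiv ?_
  ext v <;>
  · simp
    ring

/-- The deformed coproduct is a homomorphism of Poisson algebras. -/
lemma IsDeformedSl2.coproduct {N : ℕ} {z : ℝ} (hz : z ≠ 0) {a p c a' p' c' : Phase N → ℝ} {x : Phase N}
    (h : IsDeformedSl2 z a p c x) (h' : IsDeformedSl2 z a' p' c' x)
    (haa : pb a a' x = 0) (hap : pb a p' x = 0) (hac : pb a c' x = 0)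
    (hpa : pb p a' x = 0) (hpc : pb p c' x = 0)
    (hca : pb c a' x = 0) (hcp : pb c p' x = 0) :
    IsDeformedSl2 z (a + a') (twistedSum z a a' p p') (twistedSum z a a' c c') x := by
  obtain ⟨da, dp, dc, h1, h2, h3⟩ := h
  obtain ⟨da', dp', dc', h1', h2', h3'⟩ := h'
  have Hp := hasFDerivAt_twistedSum z da da' dp dp'
  have Hc := hasFDerivAt_twistedSum z da da' dc dc'
  have Ha := da.hasFDerivAt.add da'.hasFDerivAt
  have s1 := pb_swap p c x
  have s2 := pb_swap a c x
  have s3 := pb_swap p a x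
  have s1' := pb_swap p' c' x
  have s2' := pb_swap a' c' x
  have s3' := pb_swap p' a' x
  have saa := pb_swap a' a x
  have sap := pb_swap p' a x
  have sac := pb_swap c' a x
  have spa := pb_swap a' p x
  have spc := pb_swap c' p x
  have sca := pb_swap a' c x
  have scp := pb_swap p' c x
  rw [h1] at s1
  rw [h2] at s2
  rw [h3] at s3
  rw [h1'] at s1'
  rw [h2'] at s2'
  rw [h3'] at s3'
  rw [haa] at saa
  rw [hap] at sap
  rw [hac] at sac
  rw [hpa] at spa
  rw [hpc] at spc
  rw [hca] at sca
  rw [hcp] at scp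
  have n1 := pb_self a x
  have n2 := pb_self a' x
  simp only [pb_eq_poissonForm] at *
  have e1 : exp (z * (a x + a' x)) = exp (z * a x) * exp (z * a' x) := by
    rw [mul_add, exp_add]
  have e2 : exp (-(z * (a x + a' x))) = exp (-(z * a x)) * exp (-(z * a' x)) := by
    rw [mul_add, neg_add, exp_add]
  refine ⟨da.add da', Hp.differentiableAt, Hc.differentiableAt, ?_, ?_, ?_⟩
  · simp only [pb_eq_poissonForm, Hp.fderiv, Hc.fderiv, map_add, map_smul, LinearMap.add_apply,
      LinearMap.smul_apply, smul_eq_mul, Pi.add_apply, twistedSum, *]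
    simp only [cosh_eq, sinh_eq, e1, e2, exp_neg]
    have hE := exp_ne_zero (z * a x)
    have hE' := exp_ne_zero (z * a' x)
    generalize exp (z * a x) = E at *
    generalize exp (z * a' x) = E' at *
    field_simp
    ring
  · simp only [pb_eq_poissonForm, Ha.fderiv, Hc.fderiv, map_add, map_smul, LinearMap.add_apply,
      LinearMap.smul_apply, smul_eq_mul, Pi.add_apply, *]
    simp only [sinh_eq, e1, e2, exp_neg]
    have hE := exp_ne_zero (z * a x)
    have hE' := exp_ne_zero (z * a' x)
    generalize exp (z * a x) = E at *
    generalize exp (z * a' x) = E' at *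
    field_simp
    ring
  · simp only [pb_eq_poissonForm, Ha.fderiv, Hp.fderiv, map_add, map_smul, LinearMap.add_apply,
      smul_eq_mul, twistedSum, *]
    ring

/-- The Casimir function of the deformed `sl(2)` Poisson algebra. -/
def casimir {N : ℕ} (z : ℝ) (a p c : Phase N → ℝ) : Phase N → ℝ :=
  fun x => sinh (z * a x) / z * p x - c x ^ 2

lemma hasFDerivAt_casimir {N : ℕ} {z : ℝ} (hz : z ≠ 0) {a p c : Phase N → ℝ} {x : Phase N}
    (ha : DifferentiableAt ℝ a x) (hp : DifferentiableAt ℝ p x) (hc : DifferentiableAt ℝ c x) :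
    HasFDerivAt (casimir z a p c)
      ((cosh (z * a x) * p x) • fderiv ℝ a x + (sinh (z * a x) / z) • fderiv ℝ p x
        + (-2 * c x) • fderiv ℝ c x) x := by
  have h := (((ha.hasFDerivAt.const_mul z).sinh.mul_const z⁻¹).mul hp.hasFDerivAt).sub
    (hc.hasFDerivAt.pow 2)
  have h' := h.congr_fderiv (g' := (cosh (z * a x) * p x) • fderiv ℝ a x
      + (sinh (z * a x) / z) • fderiv ℝ p x + (-2 * c x) • fderiv ℝ c x) (by
    ext v <;>
    · simp
      field_simp
      ring)
  exact h'

lemma pb_casimir_of_commute {N : ℕ} {z : ℝ} (hz : z ≠ 0) {a p c f : Phase N → ℝ} {x : Phase N}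
    (ha : DifferentiableAt ℝ a x) (hp : DifferentiableAt ℝ p x) (hc : DifferentiableAt ℝ c x)
    (hfa : pb f a x = 0) (hfp : pb f p x = 0) (hfc : pb f c x = 0) :
    pb f (casimir z a p c) x = 0 := by
  rw [pb_eq_poissonForm] at *
  simp [(hasFDerivAt_casimir hz ha hp hc).fderiv, hfa, hfp, hfc]

/-- The Casimir function Poisson-commutes with the three generators. -/
lemma IsDeformedSl2.pb_casimir {N : ℕ} {z : ℝ} (hz : z ≠ 0) {a p c : Phase N → ℝ} {x : Phase N}
    (h : IsDeformedSl2 z a p c x) :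
    pb a (casimir z a p c) x = 0 ∧ pb p (casimir z a p c) x = 0 ∧
      pb c (casimir z a p c) x = 0 := by
  obtain ⟨da, dp, dc, h1, h2, h3⟩ := h
  have H := hasFDerivAt_casimir hz da dp dc
  have s1 := pb_swap p c x
  have s2 := pb_swap a c x
  have s3 := pb_swap p a x
  rw [h1] at s1
  rw [h2] at s2
  rw [h3] at s3
  simp only [pb_eq_poissonForm] at *
  refine ⟨?_, ?_, ?_⟩ <;>
  · simp only [H.fderiv, map_add, map_smul, smul_eq_mul, poissonForm_self, *]
    ring

lemma pb_twistedSum_eq_zero {N : ℕ} (z : ℝ) {a a' f f' g : Phase N → ℝ} {x : Phase N}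
    (da : DifferentiableAt ℝ a x) (da' : DifferentiableAt ℝ a' x)
    (df : DifferentiableAt ℝ f x) (df' : DifferentiableAt ℝ f' x)
    (ha : pb a g x = 0) (ha' : pb a' g x = 0) (hf : pb f g x = 0) (hf' : pb f' g x = 0) :
    pb (twistedSum z a a' f f') g x = 0 := by
  rw [pb_eq_poissonForm] at *
  simp [(hasFDerivAt_twistedSum z da da' df df').fderiv, ha, ha', hf, hf']

/-- `K_i` for the sites in `S`: the sites before `i` enter with sign `-`, those after with `+`. -/
def blockK {N : ℕ} (S : Finset (Fin N)) (i : Fin N) (q : Fin N → ℝ) : ℝ :=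
  ∑ k ∈ S, if k < i then -(q k) ^ 2 else if i < k then (q k) ^ 2 else 0

/-- The generator `J_-` built from the sites in `S`. -/
def blockMinus {N : ℕ} (S : Finset (Fin N)) : Phase N → ℝ := fun x => ∑ i ∈ S, (x.1 i) ^ 2

/-- The generator `J_+` built from the sites in `S`. -/
def blockPlus {N : ℕ} (z : ℝ) (b : Fin N → ℝ) (S : Finset (Fin N)) : Phase N → ℝ :=
  fun x => ∑ i ∈ S, (sinh (z * (x.1 i) ^ 2) / (z * (x.1 i) ^ 2) * (x.2 i) ^ 2
        + z * b i / sinh (z * (x.1 i) ^ 2)) * exp (z * blockK S i x.1)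

/-- The generator `J_3` built from the sites in `S`. -/
def blockThree {N : ℕ} (z : ℝ) (S : Finset (Fin N)) : Phase N → ℝ :=
  fun x => ∑ i ∈ S, sinh (z * (x.1 i) ^ 2) / (z * (x.1 i) ^ 2) * (x.1 i * x.2 i)
      * exp (z * blockK S i x.1)

/-- The Casimir function built from the sites in `S`. -/
def blockCasimir {N : ℕ} (z : ℝ) (b : Fin N → ℝ) (S : Finset (Fin N)) : Phase N → ℝ :=
  casimir z (blockMinus S) (blockPlus z b S) (blockThree z S)

section Support

variable {N : ℕ} (z : ℝ) (b : Fin N → ℝ) (S : Finset (Fin N))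

lemma blockK_congr {i : Fin N} {q q' : Fin N → ℝ} (h : ∀ k ∈ S, q k = q' k) :
    blockK S i q = blockK S i q' :=
  Finset.sum_congr rfl fun k hk => by rw [h k hk]

lemma supportedOn_blockMinus : SupportedOn S (blockMinus S) := fun x y h =>
  Finset.sum_congr rfl fun i hi => by rw [(h i hi).1]

lemma supportedOn_blockPlus : SupportedOn S (blockPlus z b S) := fun x y h =>
  Finset.sum_congr rfl fun i hi => by
    rw [(h i hi).1, (h i hi).2, blockK_congr S fun k hk => (h k hk).1]

lemma supportedOn_blockThree : SupportedOn S (blockThree z S) := fun x y h =>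
  Finset.sum_congr rfl fun i hi => by
    rw [(h i hi).1, (h i hi).2, blockK_congr S fun k hk => (h k hk).1]

end Support

lemma disjoint_of_forall_lt {N : ℕ} {S T : Finset (Fin N)} (hST : ∀ i ∈ S, ∀ j ∈ T, i < j) :
    Disjoint S T :=
  Finset.disjoint_left.mpr fun i hi hi' => lt_irrefl i (hST i hi i hi')

lemma blockK_union_left {N : ℕ} {S T : Finset (Fin N)} (hST : ∀ i ∈ S, ∀ j ∈ T, i < j)
    {i : Fin N} (hi : i ∈ S) (x : Phase N) :
    blockK (S ∪ T) i x.1 = blockK S i x.1 + blockMinus T x := by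
  rw [blockK, Finset.sum_union (disjoint_of_forall_lt hST), blockK, blockMinus]
  congr 1
  refine Finset.sum_congr rfl fun k hk => ?_
  rw [if_neg (hST i hi k hk).not_gt, if_pos (hST i hi k hk)]

lemma blockK_union_right {N : ℕ} {S T : Finset (Fin N)} (hST : ∀ i ∈ S, ∀ j ∈ T, i < j)
    {i : Fin N} (hi : i ∈ T) (x : Phase N) :
    blockK (S ∪ T) i x.1 = -blockMinus S x + blockK T i x.1 := by
  rw [blockK, Finset.sum_union (disjoint_of_forall_lt hST), blockK, blockMinus,
    ← Finset.sum_neg_distrib]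
  congr 1
  refine Finset.sum_congr rfl fun k hk => ?_
  rw [if_pos (hST k hk i hi)]

lemma blockMinus_union {N : ℕ} {S T : Finset (Fin N)} (hST : ∀ i ∈ S, ∀ j ∈ T, i < j) :
    blockMinus (S ∪ T) = blockMinus S + blockMinus T :=
  funext fun _ => Finset.sum_union (disjoint_of_forall_lt hST)

lemma sum_mul_exp_blockK_union {N : ℕ} {S T : Finset (Fin N)}
    (hST : ∀ i ∈ S, ∀ j ∈ T, i < j) (z : ℝ) (u : Fin N → ℝ) (x : Phase N) :
    ∑ i ∈ S ∪ T, u i * exp (z * blockK (S ∪ T) i x.1)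
      = (∑ i ∈ S, u i * exp (z * blockK S i x.1)) * exp (z * blockMinus T x)
        + exp (-(z * blockMinus S x)) * ∑ i ∈ T, u i * exp (z * blockK T i x.1) := by
  rw [Finset.sum_union (disjoint_of_forall_lt hST), Finset.sum_mul, Finset.mul_sum]
  congr 1
  · refine Finset.sum_congr rfl fun i hi => ?_
    rw [blockK_union_left hST hi, mul_add, exp_add, mul_assoc]
  · refine Finset.sum_congr rfl fun i hi => ?_
    rw [blockK_union_right hST hi, mul_add, exp_add, mul_neg]
    ring

lemma blockPlus_union {N : ℕ} {S T : Finset (Fin N)} (hST : ∀ i ∈ S, ∀ j ∈ T, i < j)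
    (z : ℝ) (b : Fin N → ℝ) :
    blockPlus z b (S ∪ T)
      = twistedSum z (blockMinus S) (blockMinus T) (blockPlus z b S) (blockPlus z b T) :=
  funext fun x => sum_mul_exp_blockK_union hST z _ x

lemma blockThree_union {N : ℕ} {S T : Finset (Fin N)} (hST : ∀ i ∈ S, ∀ j ∈ T, i < j) (z : ℝ) :
    blockThree z (S ∪ T)
      = twistedSum z (blockMinus S) (blockMinus T) (blockThree z S) (blockThree z T) :=
  funext fun x => sum_mul_exp_blockK_union hST z _ x

lemma blockK_singleton {N : ℕ} (i : Fin N) (q : Fin N → ℝ) : blockK {i} i q = 0 := by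
  simp [blockK]

lemma isDeformedSl2_singleton {N : ℕ} {z : ℝ} (hz : z ≠ 0) (b : Fin N → ℝ) (i : Fin N)
    {x : Phase N} (hx : x.1 i ≠ 0) :
    IsDeformedSl2 z (blockMinus {i}) (blockPlus z b {i}) (blockThree z {i}) x := by
  have hs : sinh (z * x.1 i ^ 2) ≠ 0 := by
    rw [Ne, sinh_eq_zero]; positivity
  let A : Phase N →L[ℝ] ℝ :=
    (ContinuousLinearMap.proj i).comp (ContinuousLinearMap.fst ℝ (Fin N → ℝ) (Fin N → ℝ))
  let B : Phase N →L[ℝ] ℝ :=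
    (ContinuousLinearMap.proj i).comp (ContinuousLinearMap.snd ℝ (Fin N → ℝ) (Fin N → ℝ))
  have hA : HasFDerivAt (fun y : Phase N => y.1 i) A x := A.hasFDerivAt
  have hB : HasFDerivAt (fun y : Phase N => y.2 i) B x := B.hasFDerivAt
  have hAB : poissonForm N A B = 1 := by
    simp [poissonForm, A, B, Pi.single_apply]
  have hBA : poissonForm N B A = -1 := by rw [poissonForm_swap, hAB]
  have hsq : HasDerivAt (fun t : ℝ => z * t ^ 2) (z * (2 * x.1 i)) (x.1 i) := by
    simpa using (hasDerivAt_pow 2 (x.1 i)).const_mul z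
  have hs0 := hsq.sinh.div hsq (by positivity)
  have hi0 := (hasDerivAt_const (x.1 i) (z * b i)).div hsq.sinh hs
  have hS := hs0.comp_hasFDerivAt x hA
  have hI := hi0.comp_hasFDerivAt x hA
  have em : blockMinus {i} = fun y : Phase N => y.1 i ^ 2 := by
    funext y
    simp [blockMinus]
  have Hm : HasFDerivAt (blockMinus {i}) ((2 * x.1 i) • A) x := by
    rw [em]
    exact (hA.pow 2).congr_fderiv (by ext v <;> simp)
  have Hp := (hS.mul (hB.pow 2)).add hI
  have Hc := hS.mul (hA.mul hB)
  have ep : blockPlus z b {i} = fun y : Phase N =>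
      sinh (z * (y.1 i) ^ 2) / (z * (y.1 i) ^ 2) * (y.2 i) ^ 2
        + z * b i / sinh (z * (y.1 i) ^ 2) := by
    funext y
    simp [blockPlus, blockK_singleton]
  have ec : blockThree z {i} = fun y : Phase N =>
      sinh (z * (y.1 i) ^ 2) / (z * (y.1 i) ^ 2) * (y.1 i * y.2 i) := by
    funext y
    simp [blockThree, blockK_singleton]
  replace Hp := Hp.congr_of_eventuallyEq (Filter.EventuallyEq.of_eq ep)
  replace Hc := Hc.congr_of_eventuallyEq (Filter.EventuallyEq.of_eq ec)
  refine ⟨Hm.differentiableAt, Hp.differentiableAt, Hc.differentiableAt, ?_, ?_, ?_⟩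
  · rw [pb_eq_poissonForm, Hp.fderiv, Hc.fderiv, ep, em]
    simp [poissonForm_self, hAB, hBA]
    field_simp
    ring
  · rw [pb_eq_poissonForm, Hm.fderiv, Hc.fderiv, em]
    simp [poissonForm_self, hBA]
    field_simp
  · rw [pb_eq_poissonForm, Hm.fderiv, Hp.fderiv, ec]
    simp [poissonForm_self, hAB]
    field_simp
    ring

section Blocks

variable {N : ℕ} {z : ℝ} {b : Fin N → ℝ} {S T : Finset (Fin N)} {x : Phase N}

/-- The generators built from any set of sites satisfy the deformed `sl(2)` relations. -/
lemma isDeformedSl2_block (hz : z ≠ 0) (hx : ∀ i, x.1 i ≠ 0) (S : Finset (Fin N)) :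
    IsDeformedSl2 z (blockMinus S) (blockPlus z b S) (blockThree z S) x := by
  induction S using Finset.induction_on_max with
  | empty =>
    have e1 : blockMinus (∅ : Finset (Fin N)) = fun _ => 0 := by funext; simp [blockMinus]
    have e2 : blockPlus z b ∅ = fun _ => 0 := by funext; simp [blockPlus]
    have e3 : blockThree z (∅ : Finset (Fin N)) = fun _ => 0 := by funext; simp [blockThree]
    rw [e1, e2, e3]
    constructor <;> simp [pb]
  | insert i S hi ih =>
    have hlt : ∀ j ∈ S, ∀ k ∈ ({i} : Finset (Fin N)), j < k := fun j hj k hk => by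
      rw [Finset.mem_singleton.mp hk]; exact hi j hj
    have h' := isDeformedSl2_singleton hz b i (hx i)
    have hd := disjoint_of_forall_lt hlt
    have sm := supportedOn_blockMinus S
    have sp := supportedOn_blockPlus z b S
    have sc := supportedOn_blockThree z S
    have sm' := supportedOn_blockMinus {i}
    have sp' := supportedOn_blockPlus z b {i}
    have sc' := supportedOn_blockThree z {i}
    obtain ⟨dm, dp, dc, -⟩ := id ih
    obtain ⟨dm', dp', dc', -⟩ := id h'
    rw [Finset.insert_eq, Finset.union_comm, blockMinus_union hlt, blockPlus_union hlt,
      blockThree_union hlt]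
    apply ih.coproduct hz h' <;> apply pb_eq_zero_of_disjoint hd <;> assumption

lemma pb_blockCasimir_of_disjoint (hz : z ≠ 0) (hx : ∀ i, x.1 i ≠ 0) (hST : Disjoint T S)
    {f : Phase N → ℝ} (hf : SupportedOn T f) (hd : DifferentiableAt ℝ f x) :
    pb f (blockCasimir z b S) x = 0 := by
  have h := isDeformedSl2_block (b := b) hz hx S
  exact pb_casimir_of_commute hz h.diff_minus h.diff_plus h.diff_three
    (pb_eq_zero_of_disjoint hST hf (supportedOn_blockMinus S) hd h.diff_minus)
    (pb_eq_zero_of_disjoint hST hf (supportedOn_blockPlus z b S) hd h.diff_plus)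
    (pb_eq_zero_of_disjoint hST hf (supportedOn_blockThree z S) hd h.diff_three)

/-- If `g` commutes with the generators of two consecutive blocks, it commutes with
those of their union. -/
lemma pb_block_union {g : Phase N → ℝ} (hz : z ≠ 0) (hx : ∀ i, x.1 i ≠ 0)
    (hST : ∀ i ∈ S, ∀ j ∈ T, i < j)
    (hS : pb (blockMinus S) g x = 0 ∧ pb (blockPlus z b S) g x = 0 ∧ pb (blockThree z S) g x = 0)
    (hT : pb (blockMinus T) g x = 0 ∧ pb (blockPlus z b T) g x = 0 ∧
      pb (blockThree z T) g x = 0) :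
    pb (blockMinus (S ∪ T)) g x = 0 ∧ pb (blockPlus z b (S ∪ T)) g x = 0 ∧
      pb (blockThree z (S ∪ T)) g x = 0 := by
  obtain ⟨dm, dp, dc, -⟩ := isDeformedSl2_block (b := b) hz hx S
  obtain ⟨dm', dp', dc', -⟩ := isDeformedSl2_block (b := b) hz hx T
  obtain ⟨h1, h2, h3⟩ := hS
  obtain ⟨h1', h2', h3'⟩ := hT
  rw [blockMinus_union hST, blockPlus_union hST, blockThree_union hST]
  refine ⟨?_, pb_twistedSum_eq_zero z dm dm' dp dp' h1 h1' h2 h2',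
    pb_twistedSum_eq_zero z dm dm' dc dc' h1 h1' h3 h3'⟩
  rw [pb_eq_poissonForm] at *
  rw [fderiv_add dm dm', map_add, LinearMap.add_apply, h1, h1', add_zero]

lemma pb_block_blockCasimir_of_disjoint (hz : z ≠ 0) (hx : ∀ i, x.1 i ≠ 0)
    (hST : Disjoint T S) :
    pb (blockMinus T) (blockCasimir z b S) x = 0 ∧
      pb (blockPlus z b T) (blockCasimir z b S) x = 0 ∧
      pb (blockThree z T) (blockCasimir z b S) x = 0 := by
  obtain ⟨dm, dp, dc, -⟩ := isDeformedSl2_block (b := b) hz hx T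
  exact ⟨pb_blockCasimir_of_disjoint hz hx hST (supportedOn_blockMinus T) dm,
    pb_blockCasimir_of_disjoint hz hx hST (supportedOn_blockPlus z b T) dp,
    pb_blockCasimir_of_disjoint hz hx hST (supportedOn_blockThree z T) dc⟩

lemma pb_block_blockCasimir_of_initial (hz : z ≠ 0) (hx : ∀ i, x.1 i ≠ 0) (hST : S ⊆ T)
    (h : ∀ i ∈ S, ∀ j ∈ T \ S, i < j) :
    pb (blockMinus T) (blockCasimir z b S) x = 0 ∧
      pb (blockPlus z b T) (blockCasimir z b S) x = 0 ∧
      pb (blockThree z T) (blockCasimir z b S) x = 0 := by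
  rw [← Finset.union_sdiff_of_subset hST]
  exact pb_block_union hz hx h ((isDeformedSl2_block hz hx S).pb_casimir hz)
    (pb_block_blockCasimir_of_disjoint hz hx Finset.sdiff_disjoint)

lemma pb_block_blockCasimir_of_final (hz : z ≠ 0) (hx : ∀ i, x.1 i ≠ 0) (hST : S ⊆ T)
    (h : ∀ i ∈ T \ S, ∀ j ∈ S, i < j) :
    pb (blockMinus T) (blockCasimir z b S) x = 0 ∧
      pb (blockPlus z b T) (blockCasimir z b S) x = 0 ∧
      pb (blockThree z T) (blockCasimir z b S) x = 0 := by
  rw [← Finset.sdiff_union_of_subset hST]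
  exact pb_block_union hz hx h (pb_block_blockCasimir_of_disjoint hz hx Finset.sdiff_disjoint)
    ((isDeformedSl2_block hz hx S).pb_casimir hz)

lemma pb_blockCasimir_of_commute (hz : z ≠ 0) (hx : ∀ i, x.1 i ≠ 0) {g : Phase N → ℝ}
    (h : pb (blockMinus T) g x = 0 ∧ pb (blockPlus z b T) g x = 0 ∧
      pb (blockThree z T) g x = 0) :
    pb (blockCasimir z b T) g x = 0 := by
  obtain ⟨dm, dp, dc, -⟩ := isDeformedSl2_block (b := b) hz hx T
  rw [pb_swap, neg_eq_zero]
  exact pb_casimir_of_commute hz dm dp dc (by rw [pb_swap, h.1, neg_zero])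
    (by rw [pb_swap, h.2.1, neg_zero]) (by rw [pb_swap, h.2.2, neg_zero])

end Blocks

/-- A function of three functions commuting with `g` commutes with `g`. -/
lemma pb_comp_eq_zero {N : ℕ} {F : ℝ × ℝ × ℝ → ℝ} {a p c g : Phase N → ℝ} {x : Phase N}
    (hF : DifferentiableAt ℝ F (a x, p x, c x)) (ha : DifferentiableAt ℝ a x)
    (hp : DifferentiableAt ℝ p x) (hc : DifferentiableAt ℝ c x)
    (hag : pb a g x = 0) (hpg : pb p g x = 0) (hcg : pb c g x = 0) :
    pb (fun y => F (a y, p y, c y)) g x = 0 := by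
  set F' := fderiv ℝ F (a x, p x, c x)
  have h := hF.hasFDerivAt.comp x
    (ha.hasFDerivAt.prodMk (hp.hasFDerivAt.prodMk hc.hasFDerivAt))
  have h' : HasFDerivAt (fun y => F (a y, p y, c y)) (F' (1, 0, 0) • fderiv ℝ a x
      + F' (0, 1, 0) • fderiv ℝ p x + F' (0, 0, 1) • fderiv ℝ c x) x := by
    refine h.congr_fderiv (ContinuousLinearMap.ext fun v => ?_)
    have e : (fderiv ℝ a x v, fderiv ℝ p x v, fderiv ℝ c x v)
        = fderiv ℝ a x v • ((1 : ℝ), (0 : ℝ), (0 : ℝ))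
          + fderiv ℝ p x v • ((0 : ℝ), (1 : ℝ), (0 : ℝ))
          + fderiv ℝ c x v • ((0 : ℝ), (0 : ℝ), (1 : ℝ)) := by simp
    change F' (fderiv ℝ a x v, fderiv ℝ p x v, fderiv ℝ c x v) = _
    rw [e, map_add, map_add, map_smul, map_smul, map_smul]
    simp [mul_comm]
  rw [pb_eq_poissonForm] at *
  simp [h'.fderiv, hag, hpg, hcg]

lemma sinh_blockMinus {N : ℕ} (z : ℝ) (S : Finset (Fin N)) (x : Phase N) :
    sinh (z * blockMinus S x) = ∑ i ∈ S, sinh (z * x.1 i ^ 2) * exp (z * blockK S i x.1) := by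
  induction S using Finset.induction_on_max with
  | empty => simp [blockMinus]
  | insert i S hi ih =>
    have hlt : ∀ j ∈ S, ∀ k ∈ ({i} : Finset (Fin N)), j < k := fun j hj k hk => by
      rw [Finset.mem_singleton.mp hk]; exact hi j hj
    have e : blockMinus {i} x = x.1 i ^ 2 := by simp [blockMinus]
    rw [Finset.insert_eq, Finset.union_comm, sum_mul_exp_blockK_union hlt, ← ih,
      blockMinus_union hlt, Finset.sum_singleton, blockK_singleton, Pi.add_apply, e, mul_zero,
      exp_zero, mul_one, mul_add, sinh_add, ← cosh_add_sinh (z * x.1 i ^ 2),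
      ← cosh_sub_sinh (z * blockMinus S x)]
    ring

lemma sum_product_eq_sum_lt_add_diag {N : ℕ} (S : Finset (Fin N)) (F : Fin N → Fin N → ℝ) :
    ∑ i ∈ S, ∑ j ∈ S, F i j
      = (∑ i ∈ S, ∑ j ∈ S, if i < j then F i j + F j i else 0) + ∑ i ∈ S, F i i := by
  have h1 : ∑ i ∈ S, F i i = ∑ i ∈ S, ∑ j ∈ S, if i = j then F i j else 0 :=
    Finset.sum_congr rfl fun i hi => by rw [Finset.sum_ite_eq, if_pos hi]
  have h2 : ∑ i ∈ S, ∑ j ∈ S, (if i < j then F i j + F j i else 0)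
      = (∑ i ∈ S, ∑ j ∈ S, if i < j then F i j else 0)
        + ∑ i ∈ S, ∑ j ∈ S, if j < i then F i j else 0 := by
    rw [Finset.sum_comm (f := fun i j => if j < i then F i j else 0), ← Finset.sum_add_distrib]
    refine Finset.sum_congr rfl fun i _ => ?_
    rw [← Finset.sum_add_distrib]
    exact Finset.sum_congr rfl fun j _ => by split_ifs <;> simp
  rw [h1, h2, ← Finset.sum_add_distrib, ← Finset.sum_add_distrib]
  refine Finset.sum_congr rfl fun i _ => ?_
  rw [← Finset.sum_add_distrib, ← Finset.sum_add_distrib]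
  refine Finset.sum_congr rfl fun j _ => ?_
  rcases lt_trichotomy i j with h | h | h
  · simp [h, h.ne, h.not_gt]
  · simp [h]
  · simp [h, h.ne', h.not_gt]

/-- The Casimir function of a block of sites, written as a sum over pairs of sites. -/
lemma blockCasimir_eq_sum {N : ℕ} {z : ℝ} (hz : z ≠ 0) (b : Fin N → ℝ) (S : Finset (Fin N))
    {x : Phase N} (hx : ∀ i, x.1 i ≠ 0) :
    blockCasimir z b S x
      = (∑ i ∈ S, ∑ j ∈ S, if i < j then
          Qz N z b i j x * exp (z * (blockK S i x.1 + blockK S j x.1)) else 0)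
        + ∑ i ∈ S, b i * exp (2 * z * blockK S i x.1) := by
  have hs : ∀ i, sinh (z * x.1 i ^ 2) ≠ 0 := fun i => by
    have := hx i
    rw [Ne, sinh_eq_zero]; positivity
  rw [blockCasimir, casimir, sinh_blockMinus, blockPlus, blockThree, sq, Finset.sum_div,
    Finset.sum_mul_sum, Finset.sum_mul_sum, ← Finset.sum_sub_distrib]
  simp only [← Finset.sum_sub_distrib]
  rw [sum_product_eq_sum_lt_add_diag]
  congr 1
  · refine Finset.sum_congr rfl fun i _ => Finset.sum_congr rfl fun j _ => ?_
    have := hs i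
    have := hs j
    have := hx i
    have := hx j
    split_ifs
    · rw [Qz, mul_add, exp_add]
      field_simp
      ring
    · rfl
  · refine Finset.sum_congr rfl fun i _ => ?_
    have := hs i
    have := hx i
    rw [show 2 * z * blockK S i x.1 = z * blockK S i x.1 + z * blockK S i x.1 by ring, exp_add]
    field_simp
    ring

/-- The sites `i < m`. -/
def leftBlock (N m : ℕ) : Finset (Fin N) := Finset.univ.filter fun i => (i : ℕ) < m

/-- The sites `i ≥ t`. -/
def rightBlock (N t : ℕ) : Finset (Fin N) := Finset.univ.filter fun i => t ≤ (i : ℕ)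

lemma leftBlock_self (N : ℕ) : leftBlock N N = Finset.univ := by simp [leftBlock]

lemma rightBlock_zero (N : ℕ) : rightBlock N 0 = Finset.univ := by simp [rightBlock]

lemma Kf_eq_blockK {N m : ℕ} {i : Fin N} (hi : (i : ℕ) < m) (q : Fin N → ℝ) :
    Kf N m i q = blockK (leftBlock N m) i q := by
  rw [blockK, leftBlock, Finset.sum_filter, Kf]
  refine Finset.sum_congr rfl fun k _ => ?_
  simp only [Fin.lt_def]
  split_ifs <;> first | rfl | omega

lemma Kt_eq_blockK {N t : ℕ} {i : Fin N} (hi : t ≤ (i : ℕ)) (q : Fin N → ℝ) :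
    Kt N t i q = blockK (rightBlock N t) i q := by
  rw [blockK, rightBlock, Finset.sum_filter, Kt]
  refine Finset.sum_congr rfl fun k _ => ?_
  simp only [Fin.lt_def]
  split_ifs <;> first | rfl | omega

lemma Czleft_eq_blockCasimir {N : ℕ} {z : ℝ} (hz : z ≠ 0) (b : Fin N → ℝ) (m : ℕ)
    {x : Phase N} (hx : ∀ i, x.1 i ≠ 0) :
    Czleft N z b m x = blockCasimir z b (leftBlock N m) x := by
  rw [blockCasimir_eq_sum hz b _ hx, Czleft]
  congr 1
  · conv_rhs => rw [leftBlock, Finset.sum_filter]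
    refine Finset.sum_congr rfl fun i _ => ?_
    rw [← leftBlock]
    split_ifs with hi
    · rw [leftBlock, Finset.sum_filter, ← leftBlock]
      refine Finset.sum_congr rfl fun j _ => ?_
      simp only [Fin.lt_def]
      by_cases hj : (j : ℕ) < m
      · simp only [hj, and_true, if_true, Kf_eq_blockK hi, Kf_eq_blockK hj]
      · rw [if_neg hj, if_neg (by omega)]
    · exact Finset.sum_eq_zero fun j _ => if_neg (by omega)
  · conv_rhs => rw [leftBlock, Finset.sum_filter]
    refine Finset.sum_congr rfl fun i _ => ?_
    rw [← leftBlock]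
    split_ifs with h
    · rw [Kf_eq_blockK h]
    · rfl

lemma Czright_eq_blockCasimir {N : ℕ} {z : ℝ} (hz : z ≠ 0) (b : Fin N → ℝ) (m : ℕ)
    {x : Phase N} (hx : ∀ i, x.1 i ≠ 0) :
    Czright N z b m x = blockCasimir z b (rightBlock N (N - m)) x := by
  rw [blockCasimir_eq_sum hz b _ hx, Czright]
  congr 1
  · conv_rhs => rw [rightBlock, Finset.sum_filter]
    refine Finset.sum_congr rfl fun i _ => ?_
    rw [← rightBlock]
    split_ifs with hi
    · rw [rightBlock, Finset.sum_filter, ← rightBlock]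
      refine Finset.sum_congr rfl fun j _ => ?_
      simp only [Fin.lt_def]
      by_cases hj : N - m ≤ (j : ℕ)
      · simp only [hi, hj, true_and, if_true, Kt_eq_blockK hi, Kt_eq_blockK hj]
      · rw [if_neg hj, if_neg (by omega)]
    · exact Finset.sum_eq_zero fun j _ => if_neg (by omega)
  · conv_rhs => rw [rightBlock, Finset.sum_filter]
    refine Finset.sum_congr rfl fun i _ => ?_
    rw [← rightBlock]
    split_ifs with h
    · rw [Kt_eq_blockK h]
    · rfl

lemma Jmz_eq_blockMinus (N : ℕ) : Jmz N = blockMinus Finset.univ := rfl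

lemma Jpz_eq_blockPlus (N : ℕ) (z : ℝ) (b : Fin N → ℝ) :
    Jpz N z b = blockPlus z b Finset.univ := by
  funext x
  exact Finset.sum_congr rfl fun i _ => by rw [Kf_eq_blockK i.isLt, leftBlock_self]

lemma J3z_eq_blockThree (N : ℕ) (z : ℝ) : J3z N z = blockThree z Finset.univ := by
  funext x
  exact Finset.sum_congr rfl fun i _ => by rw [Kf_eq_blockK i.isLt, leftBlock_self]

open Filter Topology in
lemma eventually_forall_ne_zero {N : ℕ} {x : Phase N} (hx : ∀ i, x.1 i ≠ 0) :
    ∀ᶠ y in 𝓝 x, ∀ i, y.1 i ≠ 0 :=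
  eventually_all.mpr fun i =>
    ((continuous_apply i).comp continuous_fst).continuousAt.eventually_ne (hx i)

/-- Theorem 2: for any smooth `𝓗 : ℝ³ → ℝ`, the Hamiltonian
`H_z = 𝓗(J_-^{(N)}, J_+^{(N)}, J_3^{(N)})` built on the deformed realization
Poisson-commutes with each of the `2N−3` deformed integrals `C_z^{(m)}`,
`C_{z,(m)}` (`2 ≤ m ≤ N`, with `C_z^{(N)} = C_{z,(N)}`), and each of the two
sets `{H_z, C_z^{(2)},…,C_z^{(N)}}` and `{H_z, C_{z,(2)},…,C_{z,(N)}}` is in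
involution. -/
theorem theorem2_deformed_QMS (N : ℕ) (hN : 2 ≤ N) (z : ℝ) (hz : z ≠ 0)
    (b : Fin N → ℝ) (𝓗 : ℝ × ℝ × ℝ → ℝ) (h𝓗 : ContDiff ℝ (⊤ : ℕ∞) 𝓗)
    (H : Phase N → ℝ)
    (hH : H = fun x => 𝓗 (Jmz N x, Jpz N z b x, J3z N z x))
    (x : Phase N) (hx : ∀ i, x.1 i ≠ 0) :
    (∀ m : ℕ, 2 ≤ m → m ≤ N →
      pb H (Czleft N z b m) x = 0 ∧ pb H (Czright N z b m) x = 0) ∧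
    Czleft N z b N x = Czright N z b N x ∧
    (∀ m k : ℕ, 2 ≤ m → m ≤ N → 2 ≤ k → k ≤ N →
      pb (Czleft N z b m) (Czleft N z b k) x = 0 ∧
      pb (Czright N z b m) (Czright N z b k) x = 0) := by
  have hC : ∀ m, Czleft N z b m =ᶠ[nhds x] blockCasimir z b (leftBlock N m) := fun m =>
    (eventually_forall_ne_zero hx).mono fun y hy => Czleft_eq_blockCasimir hz b m hy
  have hC' : ∀ m, Czright N z b m =ᶠ[nhds x] blockCasimir z b (rightBlock N (N - m)) := fun m =>
    (eventually_forall_ne_zero hx).mono fun y hy => Czright_eq_blockCasimir hz b m hy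
  have hL : ∀ m k, m ≤ k → _ := fun m k hmk =>
    pb_block_blockCasimir_of_initial (b := b) (S := leftBlock N m) (T := leftBlock N k) hz hx
      (by intro i; simp only [leftBlock, Finset.mem_filter_univ]; omega)
      (by
        intro i hi j hj
        simp only [leftBlock, Finset.mem_filter_univ, Finset.mem_sdiff] at hi hj
        omega)
  have hR : ∀ s t, t ≤ s → _ := fun s t hts =>
    pb_block_blockCasimir_of_final (b := b) (S := rightBlock N s) (T := rightBlock N t) hz hx
      (by intro i; simp only [rightBlock, Finset.mem_filter_univ]; omega)
      (by
        intro i hi j hj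
        simp only [rightBlock, Finset.mem_filter_univ, Finset.mem_sdiff] at hi hj
        omega)
  obtain ⟨dm, dp, dc, -⟩ := isDeformedSl2_block (b := b) hz hx Finset.univ
  have hF : Differentiable ℝ 𝓗 := h𝓗.differentiable (by simp)
  refine ⟨fun m _ hm => ⟨?_, ?_⟩, ?_, fun m k _ _ _ _ => ⟨?_, ?_⟩⟩
  · rw [pb_congr (Filter.EventuallyEq.refl _ H) (hC m), hH, Jmz_eq_blockMinus, Jpz_eq_blockPlus,
      J3z_eq_blockThree]
    have h := hL m N hm
    rw [leftBlock_self] at h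
    exact pb_comp_eq_zero (hF _) dm dp dc h.1 h.2.1 h.2.2
  · rw [pb_congr (Filter.EventuallyEq.refl _ H) (hC' m), hH, Jmz_eq_blockMinus, Jpz_eq_blockPlus,
      J3z_eq_blockThree]
    have h := hR (N - m) 0 (Nat.zero_le _)
    rw [rightBlock_zero] at h
    exact pb_comp_eq_zero (hF _) dm dp dc h.1 h.2.1 h.2.2
  · rw [Czleft_eq_blockCasimir hz b N hx, Czright_eq_blockCasimir hz b N hx, Nat.sub_self,
      leftBlock_self, rightBlock_zero]
  · rw [pb_congr (hC m) (hC k)]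
    rcases le_total m k with h | h
    · rw [pb_swap, pb_blockCasimir_of_commute hz hx (hL m k h), neg_zero]
    · exact pb_blockCasimir_of_commute hz hx (hL k m h)
  · rw [pb_congr (hC' m) (hC' k)]
    rcases le_total (N - m) (N - k) with h | h
    · exact pb_blockCasimir_of_commute hz hx (hR _ _ h)
    · rw [pb_swap, pb_blockCasimir_of_commute hz hx (hR _ _ h), neg_zero]
end
end

section
/- Let z ≠ 0 be real and let f : ℝ → ℝ be a smooth positive function. On the open subset of ℝ² where q_1 ≠ 0 and q_2 ≠ 0, consider the diagonal metric determined by the Hamiltonian H = ½ J_+ f(z J_-), namely g_{11} = (2 z q_1²/sinh(z q_1²)) e^{−z q_2²} / f(x) and g_{22} = (2 z q_2²/sinh(z q_2²)) e^{z q_1²} / f(x), where x = z(q_1² + q_2²). Then its Gaussian curvature is K = z ( f'(x) cosh x + ( f''(x) − f(x) − f'(x)²/f(x) ) sinh x ). -/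
open Real

noncomputable section

/-- Partial derivative in the first coordinate of a function on ℝ². -/
noncomputable def pd1 (f : ℝ × ℝ → ℝ) (x : ℝ × ℝ) : ℝ :=
  deriv (fun t => f (t, x.2)) x.1

/-- Partial derivative in the second coordinate of a function on ℝ². -/
noncomputable def pd2 (f : ℝ × ℝ → ℝ) (x : ℝ × ℝ) : ℝ :=
  deriv (fun t => f (x.1, t)) x.2

/-- Gaussian curvature of the diagonal metric `ds² = g₁₁ dq₁² + g₂₂ dq₂²`:
`K = −(1/√(g₁₁g₂₂)) [ ∂₁((1/√g₁₁) ∂₁√g₂₂) + ∂₂((1/√g₂₂) ∂₂√g₁₁) ]`. -/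
noncomputable def gaussK (g11 g22 : ℝ × ℝ → ℝ) (x : ℝ × ℝ) : ℝ :=
  -(1 / Real.sqrt (g11 x * g22 x)) *
    (pd1 (fun y => 1 / Real.sqrt (g11 y) * pd1 (fun w => Real.sqrt (g22 w)) y) x
      + pd2 (fun y => 1 / Real.sqrt (g22 y) * pd2 (fun w => Real.sqrt (g11 w)) y) x)

/-- The factor `2u / sinh u` at `u = z t²`. -/
def sinhFactor (z t : ℝ) : ℝ := 2 * z * t ^ 2 / Real.sinh (z * t ^ 2)

lemma sinh_mul_sq_ne_zero {z t : ℝ} (hz : z ≠ 0) (ht : t ≠ 0) :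
    Real.sinh (z * t ^ 2) ≠ 0 := by
  rw [Ne, Real.sinh_eq_zero]
  positivity

lemma sinhFactor_pos {z t : ℝ} (hz : z ≠ 0) (ht : t ≠ 0) : 0 < sinhFactor z t := by
  have ht2 : 0 < t ^ 2 := by positivity
  unfold sinhFactor
  rcases lt_or_gt_of_ne hz with h | h
  · exact div_pos_of_neg_of_neg (by nlinarith) (Real.sinh_neg_iff.2 (by nlinarith))
  · exact div_pos (by positivity) (Real.sinh_pos_iff.2 (by positivity))

lemma hasDerivAt_mul_sq (z t : ℝ) : HasDerivAt (fun s : ℝ => z * s ^ 2) (2 * z * t) t := by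
  refine HasDerivAt.congr_deriv ((hasDerivAt_pow 2 t).const_mul z) ?_
  push_cast
  ring

lemma hasDerivAt_mul_sq_add_sq (z t r : ℝ) :
    HasDerivAt (fun s : ℝ => z * (s ^ 2 + r ^ 2)) (2 * z * t) t := by
  refine HasDerivAt.congr_deriv (((hasDerivAt_pow 2 t).add_const (r ^ 2)).const_mul z) ?_
  push_cast
  ring

lemma hasDerivAt_sinhFactor {z t : ℝ} (hz : z ≠ 0) (ht : t ≠ 0) :
    HasDerivAt (sinhFactor z)
      (sinhFactor z t * (2 / t - 2 * z * t * Real.cosh (z * t ^ 2) / Real.sinh (z * t ^ 2))) t := by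
  have hs := sinh_mul_sq_ne_zero hz ht
  refine HasDerivAt.congr_deriv ((hasDerivAt_mul_sq (2 * z) t).div (hasDerivAt_mul_sq z t).sinh hs) ?_
  unfold sinhFactor
  field_simp

/-- A square root has half the logarithmic derivative. -/
lemma HasDerivAt.sqrt_of_logDeriv {g : ℝ → ℝ} {l t : ℝ} (hg : HasDerivAt g (g t * l) t)
    (hpos : 0 < g t) : HasDerivAt (fun s => √(g s)) (√(g t) * (l / 2)) t := by
  refine HasDerivAt.congr_deriv (hg.sqrt hpos.ne') ?_
  have := Real.sqrt_pos.2 hpos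
  field_simp
  rw [Real.sq_sqrt hpos.le, mul_comm]

/-- The coefficient of the metric in the direction of `t`; the sign `ε` is that of the exponent
in the complementary coefficient. -/
def metricCoeff (z ε : ℝ) (f : ℝ → ℝ) (t r : ℝ) : ℝ :=
  sinhFactor z t * Real.exp (-(ε * (z * r ^ 2))) / f (z * (t ^ 2 + r ^ 2))

section

variable {z : ℝ} {f : ℝ → ℝ} {t r : ℝ}

lemma metricCoeff_pos (hz : z ≠ 0) (hfpos : ∀ t, 0 < f t) (ε : ℝ) (ht : t ≠ 0) :
    0 < metricCoeff z ε f t r :=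
  div_pos (mul_pos (sinhFactor_pos hz ht) (Real.exp_pos _)) (hfpos _)

lemma hasDerivAt_sqrt_metricCoeff (hz : z ≠ 0) (hf : Differentiable ℝ f) (hfpos : ∀ t, 0 < f t)
    (ε : ℝ) (hr : r ≠ 0) :
    HasDerivAt (fun s => √(metricCoeff z (-ε) f r s))
      (√(metricCoeff z (-ε) f r t) *
        (z * t * (ε - logDeriv f (z * (t ^ 2 + r ^ 2))))) t := by
  have hd : HasDerivAt (fun s => metricCoeff z (-ε) f r s)
      (metricCoeff z (-ε) f r t *
        (2 * z * t * (ε - logDeriv f (z * (t ^ 2 + r ^ 2))))) t := by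
    have hF : HasDerivAt (fun s => f (z * (r ^ 2 + s ^ 2)))
        (deriv f (z * (r ^ 2 + t ^ 2)) * (2 * z * t)) t := by
      simp_rw [add_comm (r ^ 2)]
      exact (hf _).hasDerivAt.comp t (hasDerivAt_mul_sq_add_sq z t r)
    have hE : HasDerivAt (fun s => Real.exp (-(-ε * (z * s ^ 2))))
        (Real.exp (-(-ε * (z * t ^ 2))) * -(-ε * (2 * z * t))) t :=
      ((hasDerivAt_mul_sq z t).const_mul (-ε)).neg.exp
    refine HasDerivAt.congr_deriv ((hE.const_mul (sinhFactor z r)).div hF (hfpos _).ne') ?_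
    have := (hfpos (z * (r ^ 2 + t ^ 2))).ne'
    rw [add_comm (t ^ 2)]
    unfold metricCoeff
    rw [logDeriv_apply]
    field_simp
  refine HasDerivAt.congr_deriv (hd.sqrt_of_logDeriv (metricCoeff_pos hz hfpos _ hr)) ?_
  ring

lemma metricCoeff_ratio (hfpos : ∀ t, 0 < f t) (ε : ℝ) :
    metricCoeff z (-ε) f r t / metricCoeff z ε f t r =
      sinhFactor z r * Real.exp (ε * (z * (t ^ 2 + r ^ 2))) / sinhFactor z t := by
  have := (hfpos (z * (t ^ 2 + r ^ 2))).ne'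
  unfold metricCoeff
  rw [add_comm (r ^ 2), show ε * (z * (t ^ 2 + r ^ 2)) =
    -(-ε * (z * t ^ 2)) + ε * (z * r ^ 2) by ring, Real.exp_add, Real.exp_neg (ε * (z * r ^ 2))]
  field_simp

/-- One of the two second-order terms of the curvature, normalised by the area density. -/
lemma curvature_term (hz : z ≠ 0) (hf : ContDiff ℝ 2 f) (hfpos : ∀ t, 0 < f t) (ε : ℝ)
    (ht : t ≠ 0) (hr : r ≠ 0) :
    1 / √(metricCoeff z ε f t r * metricCoeff z (-ε) f r t) *
      deriv (fun s => 1 / √(metricCoeff z ε f s r) *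
        deriv (fun w => √(metricCoeff z (-ε) f r w)) s) t =
    z / 2 * f (z * (t ^ 2 + r ^ 2)) * Real.exp (ε * (z * r ^ 2)) *
      ((Real.cosh (z * t ^ 2) + ε * Real.sinh (z * t ^ 2)) *
          (ε - logDeriv f (z * (t ^ 2 + r ^ 2)))
        - 2 * Real.sinh (z * t ^ 2) * deriv (logDeriv f) (z * (t ^ 2 + r ^ 2))) := by
  have hfd : Differentiable ℝ f := hf.differentiable (by norm_num)
  have hfd' : Differentiable ℝ (deriv f) :=
    (ContDiff.deriv' (n := 1) hf).differentiable (by norm_num)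
  have hLd : Differentiable ℝ (logDeriv f) := hfd'.div hfd fun s => (hfpos s).ne'
  set h : ℝ → ℝ := fun s =>
    sinhFactor z r * Real.exp (ε * (z * (s ^ 2 + r ^ 2))) / sinhFactor z s with hh
  have hev : (fun s => 1 / √(metricCoeff z ε f s r) *
        deriv (fun w => √(metricCoeff z (-ε) f r w)) s) =ᶠ[nhds t]
      fun s => √(h s) * (z * s * (ε - logDeriv f (z * (s ^ 2 + r ^ 2)))) := by
    filter_upwards [] with s
    rw [(hasDerivAt_sqrt_metricCoeff hz hfd hfpos ε hr).deriv, hh]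
    simp only
    rw [← metricCoeff_ratio hfpos, Real.sqrt_div (metricCoeff_pos hz hfpos _ hr).le]
    ring
  have hS := sinhFactor_pos hz ht
  have hsinh := sinh_mul_sq_ne_zero hz ht
  have hpos : 0 < h t := by
    have := sinhFactor_pos hz hr
    simp only [hh]
    positivity
  have hder : HasDerivAt h (h t * (2 * (z * t * ε - 1 / t +
      z * t * Real.cosh (z * t ^ 2) / Real.sinh (z * t ^ 2)))) t := by
    refine HasDerivAt.congr_deriv ((((hasDerivAt_mul_sq_add_sq z t r).const_mul ε).exp.const_mul
      (sinhFactor z r)).div (hasDerivAt_sinhFactor hz ht) hS.ne') ?_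
    simp only [hh]
    field_simp
    ring
  have hL : HasDerivAt (fun s => logDeriv f (z * (s ^ 2 + r ^ 2)))
      (deriv (logDeriv f) (z * (t ^ 2 + r ^ 2)) * (2 * z * t)) t :=
    (hLd _).hasDerivAt.comp t (hasDerivAt_mul_sq_add_sq z t r)
  have hprod := (hder.sqrt_of_logDeriv hpos).mul
    (((hasDerivAt_id t).const_mul z).mul (hL.const_sub ε))
  have hA : 0 < metricCoeff z ε f t r := metricCoeff_pos hz hfpos ε ht
  have hsq : 1 / √(metricCoeff z ε f t r * metricCoeff z (-ε) f r t) * √(h t) =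
      1 / metricCoeff z ε f t r := by
    have hB : 0 < metricCoeff z (-ε) f r t := metricCoeff_pos hz hfpos _ hr
    simp only [hh]
    rw [← metricCoeff_ratio hfpos, Real.sqrt_mul hA.le, Real.sqrt_div hB.le]
    have h1 := Real.sqrt_pos.2 hA
    have h2 := Real.sqrt_pos.2 hB
    field_simp
    exact (Real.sq_sqrt hA.le).symm
  have hinv : 1 / metricCoeff z ε f t r = f (z * (t ^ 2 + r ^ 2)) * Real.exp (ε * (z * r ^ 2)) *
      Real.sinh (z * t ^ 2) / (2 * z * t ^ 2) := by
    unfold metricCoeff sinhFactor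
    rw [Real.exp_neg]
    have := (hfpos (z * (t ^ 2 + r ^ 2))).ne'
    field_simp
  rw [hev.deriv_eq]
  refine (congrArg _ hprod.deriv).trans ?_
  simp only [id, Pi.mul_apply]
  generalize logDeriv f (z * (t ^ 2 + r ^ 2)) = L
  generalize deriv (logDeriv f) (z * (t ^ 2 + r ^ 2)) = L'
  trans (1 / √(metricCoeff z ε f t r * metricCoeff z (-ε) f r t) * √(h t)) *
    ((z * t * ε - 1 / t + z * t * Real.cosh (z * t ^ 2) / Real.sinh (z * t ^ 2)) *
      (z * t * (ε - L)) + (z * (ε - L) - z * t * (L' * (2 * z * t))))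
  · ring
  rw [hsq, hinv]
  field_simp
  ring

end

/-- for a smooth positive `f`, the metric determined by
`H = ½ J₊ f(zJ₋)`, namely `g₁₁ = (2zq₁²/sinh(zq₁²)) e^{−zq₂²}/f(x)`,
`g₂₂ = (2zq₂²/sinh(zq₂²)) e^{zq₁²}/f(x)` with `x = z(q₁²+q₂²)`, has Gaussian
curvature `K = z (f'(x) cosh x + (f''(x) − f(x) − f'(x)²/f(x)) sinh x)`. -/
theorem curvature_general_case (z : ℝ) (hz : z ≠ 0)
    (f : ℝ → ℝ) (hf : ContDiff ℝ (⊤ : ℕ∞) f) (hfpos : ∀ t, 0 < f t)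
    (x : ℝ × ℝ) (h1 : x.1 ≠ 0) (h2 : x.2 ≠ 0) :
    gaussK
      (fun y => 2 * z * y.1 ^ 2 / Real.sinh (z * y.1 ^ 2)
        * Real.exp (-(z * y.2 ^ 2)) / f (z * (y.1 ^ 2 + y.2 ^ 2)))
      (fun y => 2 * z * y.2 ^ 2 / Real.sinh (z * y.2 ^ 2)
        * Real.exp (z * y.1 ^ 2) / f (z * (y.1 ^ 2 + y.2 ^ 2)))
      x
      = z * (deriv f (z * (x.1 ^ 2 + x.2 ^ 2)) * Real.cosh (z * (x.1 ^ 2 + x.2 ^ 2))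
          + (deriv (deriv f) (z * (x.1 ^ 2 + x.2 ^ 2))
              - f (z * (x.1 ^ 2 + x.2 ^ 2))
              - (deriv f (z * (x.1 ^ 2 + x.2 ^ 2))) ^ 2 / f (z * (x.1 ^ 2 + x.2 ^ 2)))
            * Real.sinh (z * (x.1 ^ 2 + x.2 ^ 2))) := by
  have hf2 : ContDiff ℝ 2 f := contDiff_infty.1 hf 2
  have hfd : Differentiable ℝ f := hf2.differentiable (by norm_num)
  have hfd' : Differentiable ℝ (deriv f) :=
    (ContDiff.deriv' (n := 1) hf2).differentiable (by norm_num)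
  have e1 : ∀ a b : ℝ, 2 * z * a ^ 2 / Real.sinh (z * a ^ 2)
      * Real.exp (-(z * b ^ 2)) / f (z * (a ^ 2 + b ^ 2)) = metricCoeff z 1 f a b := by
    intro a b
    simp [metricCoeff, sinhFactor]
  have e2 : ∀ a b : ℝ, 2 * z * b ^ 2 / Real.sinh (z * b ^ 2)
      * Real.exp (z * a ^ 2) / f (z * (a ^ 2 + b ^ 2)) = metricCoeff z (-1) f b a := by
    intro a b
    simp [metricCoeff, sinhFactor, add_comm]
  have T1 := curvature_term hz hf2 hfpos 1 h1 h2
  have T2 := curvature_term hz hf2 hfpos (-1) h2 h1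
  rw [neg_neg, mul_comm (metricCoeff z (-1) f x.2 x.1), add_comm (x.2 ^ 2)] at T2
  simp only [gaussK, pd1, pd2, e1, e2]
  rw [neg_mul, mul_add, T1, T2]
  have hX : deriv (logDeriv f) (z * (x.1 ^ 2 + x.2 ^ 2)) =
      (deriv (deriv f) (z * (x.1 ^ 2 + x.2 ^ 2)) * f (z * (x.1 ^ 2 + x.2 ^ 2)) -
        deriv f (z * (x.1 ^ 2 + x.2 ^ 2)) * deriv f (z * (x.1 ^ 2 + x.2 ^ 2))) /
        f (z * (x.1 ^ 2 + x.2 ^ 2)) ^ 2 :=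
    ((hfd' _).hasDerivAt.div (hfd _).hasDerivAt (hfpos _).ne').deriv
  rw [hX, logDeriv_apply, mul_add z, Real.cosh_add, Real.sinh_add, ← mul_add z]
  have := (hfpos (z * (x.1 ^ 2 + x.2 ^ 2))).ne'
  simp only [one_mul, neg_one_mul, ← Real.cosh_add_sinh, Real.cosh_neg, Real.sinh_neg]
  field_simp
  ring
end
end

section
/- Let N ≥ 2, let κ, k be real constants, let b_1,…,b_N be real parameters, fix an index i with b_i = 0, and work on the open subset of ℝ^{2N} where every q_l ≠ 0, 𝐪² ≠ 0 and 1 + κ𝐪² > 0. Define the Beltrami Kepler–Coulomb Hamiltonian H^B = ½ (1 + κ𝐪²)( 𝐩² + κ(𝐪·𝐩)² ) − k/√(𝐪²) + Σ_{l=1}^N b_l (1 + κ𝐪²)/(2 q_l²) and the function L_i^B = Σ_{l=1}^N ( p_l + κ(𝐪·𝐩) q_l )( q_l p_i − q_i p_l ) + k q_i/√(𝐪²) − Σ_{l=1, l≠i}^N b_l q_i/q_l². Then {L_i^B, H^B} = 0 with respect to the canonical Poisson bracket. -/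
open scoped BigOperators
open Real

noncomputable section

/-- `𝐪² = Σ q_l²`. -/
noncomputable def qq (N : ℕ) : Phase N → ℝ := fun x => ∑ l : Fin N, (x.1 l) ^ 2

/-- `𝐩² = Σ p_l²`. -/
noncomputable def pp (N : ℕ) : Phase N → ℝ := fun x => ∑ l : Fin N, (x.2 l) ^ 2

/-- `𝐪·𝐩 = Σ q_l p_l`. -/
noncomputable def qp (N : ℕ) : Phase N → ℝ := fun x => ∑ l : Fin N, x.1 l * x.2 l

/-- The Beltrami Kepler–Coulomb Hamiltonian
`H^B = ½(1+κ𝐪²)(𝐩² + κ(𝐪·𝐩)²) − k/√(𝐪²) + Σ_l b_l (1+κ𝐪²)/(2q_l²)`. -/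
noncomputable def HKC (N : ℕ) (κ k : ℝ) (b : Fin N → ℝ) : Phase N → ℝ := fun x =>
  1 / 2 * (1 + κ * qq N x) * (pp N x + κ * (qp N x) ^ 2)
    - k / Real.sqrt (qq N x)
    + ∑ l : Fin N, b l * (1 + κ * qq N x) / (2 * (x.1 l) ^ 2)

/-- The Laplace–Runge–Lenz-type function
`L_i^B = Σ_l (p_l + κ(𝐪·𝐩)q_l)(q_l p_i − q_i p_l) + k q_i/√(𝐪²)
 − Σ_{l≠i} b_l q_i/q_l²`. -/
noncomputable def LKC (N : ℕ) (κ k : ℝ) (b : Fin N → ℝ) (i : Fin N) :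
    Phase N → ℝ := fun x =>
  (∑ l : Fin N, (x.2 l + κ * qp N x * x.1 l) * (x.1 l * x.2 i - x.1 i * x.2 l))
    + k * x.1 i / Real.sqrt (qq N x)
    - ∑ l : Fin N, if l ≠ i then b l * x.1 i / (x.1 l) ^ 2 else 0

/-- The sum `∑ b_l / q_l²` of the inverse-square terms. -/
def centrifugal {N : ℕ} (b : Fin N → ℝ) : Phase N → ℝ :=
  fun x => ∑ l : Fin N, b l / (x.1 l) ^ 2

theorem HKC_eq (N : ℕ) (κ k : ℝ) (b : Fin N → ℝ) :
    HKC N κ k b = fun x => 1 / 2 * (1 + κ * qq N x) * (pp N x + κ * (qp N x) ^ 2)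
      - k / √(qq N x) + 1 / 2 * (1 + κ * qq N x) * centrifugal b x := by
  funext x
  simp only [HKC, centrifugal, Finset.mul_sum]
  congr 1
  refine Finset.sum_congr rfl fun l _ => ?_
  rw [div_mul_eq_div_div_swap]
  ring

theorem LKC_eq (N : ℕ) (κ k : ℝ) (b : Fin N → ℝ) (i : Fin N) (hbi : b i = 0) :
    LKC N κ k b i = fun x => qp N x * (1 + κ * qq N x) * x.2 i
      - x.1 i * (pp N x + κ * (qp N x) ^ 2) + k * x.1 i / √(qq N x)
      - x.1 i * centrifugal b x := by
  funext x
  have h : ∀ s : ℝ, ∑ l : Fin N, (x.2 l + κ * s * x.1 l) * (x.1 l * x.2 i - x.1 i * x.2 l)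
      = qp N x * x.2 i - x.1 i * pp N x
        + κ * s * (qq N x * x.2 i - x.1 i * qp N x) := by
    intro s
    simp only [qp, pp, qq, Finset.mul_sum, Finset.sum_mul, ← Finset.sum_sub_distrib,
      ← Finset.sum_add_distrib]
    exact Finset.sum_congr rfl fun l _ => by ring
  have hB : (∑ l : Fin N, if l ≠ i then b l * x.1 i / (x.1 l) ^ 2 else 0)
      = x.1 i * centrifugal b x := by
    simp only [centrifugal, Finset.mul_sum]
    refine Finset.sum_congr rfl fun l _ => ?_
    split_ifs with hl
    · ring
    · rw [not_not.mp hl, hbi]; simp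
  simp only [LKC]
  rw [h, hB]
  ring

/-- A directional derivative can be read off the restriction to a line. -/
theorem fderiv_apply_of_hasDerivAt_line {E : Type*} [NormedAddCommGroup E] [NormedSpace ℝ E]
    {f : E → ℝ} {x v : E} {d : ℝ} (hf : DifferentiableAt ℝ f x)
    (h : HasDerivAt (fun t : ℝ => f (x + t • v)) d 0) : fderiv ℝ f x v = d :=
  (hf.hasFDerivAt.hasLineDerivAt v).unique h

section Line

variable {N : ℕ} (x v : Phase N)

theorem hasDerivAt_line_fst (l : Fin N) :
    HasDerivAt (fun t : ℝ => (x + t • v).1 l) (v.1 l) 0 := by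
  simpa using ((hasDerivAt_id (0 : ℝ)).mul_const (v.1 l)).const_add (x.1 l)

theorem hasDerivAt_line_snd (l : Fin N) :
    HasDerivAt (fun t : ℝ => (x + t • v).2 l) (v.2 l) 0 := by
  simpa using ((hasDerivAt_id (0 : ℝ)).mul_const (v.2 l)).const_add (x.2 l)

theorem hasDerivAt_line_qq :
    HasDerivAt (fun t : ℝ => qq N (x + t • v)) (2 * ∑ l, x.1 l * v.1 l) 0 := by
  rw [Finset.mul_sum]
  exact HasDerivAt.fun_sum fun l _ => by
    refine HasDerivAt.congr_deriv
      ((hasDerivAt_line_fst x v l).fun_pow 2) ?_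
    simp; ring

theorem hasDerivAt_line_pp :
    HasDerivAt (fun t : ℝ => pp N (x + t • v)) (2 * ∑ l, x.2 l * v.2 l) 0 := by
  rw [Finset.mul_sum]
  exact HasDerivAt.fun_sum fun l _ => by
    refine HasDerivAt.congr_deriv
      ((hasDerivAt_line_snd x v l).fun_pow 2) ?_
    simp; ring

theorem hasDerivAt_line_qp :
    HasDerivAt (fun t : ℝ => qp N (x + t • v)) (∑ l, (v.1 l * x.2 l + x.1 l * v.2 l)) 0 :=
  HasDerivAt.fun_sum fun l _ => by
    refine HasDerivAt.congr_deriv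
      ((hasDerivAt_line_fst x v l).fun_mul (hasDerivAt_line_snd x v l)) ?_
    simp

theorem hasDerivAt_line_centrifugal (b : Fin N → ℝ) (hx : ∀ l, x.1 l ≠ 0) :
    HasDerivAt (fun t : ℝ => centrifugal b (x + t • v))
      (-2 * ∑ l, b l / (x.1 l) ^ 3 * v.1 l) 0 := by
  rw [Finset.mul_sum]
  exact HasDerivAt.fun_sum fun l _ => by
    refine HasDerivAt.congr_deriv
      ((hasDerivAt_const (0 : ℝ) (b l)).fun_div ((hasDerivAt_line_fst x v l).fun_pow 2)
      (by simpa using hx l)) ?_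
    have := hx l
    simp
    field_simp

theorem hasDerivAt_line_inv_sqrt_qq (hq : qq N x ≠ 0) :
    HasDerivAt (fun t : ℝ => (√(qq N (x + t • v)))⁻¹)
      (-(∑ l, x.1 l * v.1 l) / √(qq N x) ^ 3) 0 := by
  have h0 : 0 ≤ qq N x := Finset.sum_nonneg fun l _ => sq_nonneg _
  have hr : √(qq N x) ≠ 0 := (Real.sqrt_pos.mpr (lt_of_le_of_ne h0 hq.symm)).ne'
  refine HasDerivAt.congr_deriv
      (((hasDerivAt_line_qq x v).sqrt (by simpa using hq)).fun_inv (by simpa using hr)) ?_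
  simp
  field_simp

end Line

section Differentiability

variable {N : ℕ} {x : Phase N}

theorem differentiableAt_centrifugal (b : Fin N → ℝ) (hx : ∀ l, x.1 l ≠ 0) :
    DifferentiableAt ℝ (centrifugal b) x := by
  have h l := pow_ne_zero 2 (hx l)
  unfold centrifugal
  fun_prop (disch := exact h _)

theorem differentiable_qq : Differentiable ℝ (qq N) := by unfold qq; fun_prop

theorem differentiable_pp : Differentiable ℝ (pp N) := by unfold pp; fun_prop

theorem differentiable_qp : Differentiable ℝ (qp N) := by unfold qp; fun_prop

theorem differentiableAt_inv_sqrt_qq (hq : qq N x ≠ 0) :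
    DifferentiableAt ℝ (fun y => (√(qq N y))⁻¹) x := by
  have h0 : 0 ≤ qq N x := Finset.sum_nonneg fun l _ => sq_nonneg _
  exact (differentiable_qq.differentiableAt.sqrt hq).fun_inv
    (Real.sqrt_pos.mpr (lt_of_le_of_ne h0 hq.symm)).ne'

end Differentiability

section Gradients

variable {N : ℕ} (κ k : ℝ) (b : Fin N → ℝ) (x v : Phase N)

theorem fderiv_HKC (hx : ∀ l, x.1 l ≠ 0) (hq : qq N x ≠ 0) :
    fderiv ℝ (HKC N κ k b) x v =
      (κ * (pp N x + κ * qp N x ^ 2 + centrifugal b x) + k / √(qq N x) ^ 3)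
          * (∑ l, x.1 l * v.1 l)
        + (1 + κ * qq N x) * (∑ l, x.2 l * v.2 l
          + κ * qp N x * ∑ l, (v.1 l * x.2 l + x.1 l * v.2 l)
          - ∑ l, b l / (x.1 l) ^ 3 * v.1 l) := by
  have hB := differentiableAt_centrifugal b hx
  have hR := differentiableAt_inv_sqrt_qq hq
  have h1 := (differentiable_qq (N := N)).differentiableAt (x := x)
  have h2 := (differentiable_pp (N := N)).differentiableAt (x := x)
  have h3 := (differentiable_qp (N := N)).differentiableAt (x := x)
  rw [HKC_eq]
  simp only [div_eq_mul_inv k]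
  refine fderiv_apply_of_hasDerivAt_line (by fun_prop) ?_
  have hA := ((hasDerivAt_line_qq x v).const_mul κ).const_add 1 |>.const_mul (1 / 2)
  refine HasDerivAt.congr_deriv
      (((hA.fun_mul ((hasDerivAt_line_pp x v).fun_add
    (((hasDerivAt_line_qp x v).fun_pow 2).const_mul κ))).fun_sub
    ((hasDerivAt_line_inv_sqrt_qq x v hq).const_mul k)).fun_add
    (hA.fun_mul (hasDerivAt_line_centrifugal x v b hx))) ?_
  simp only [zero_smul, add_zero]
  push_cast
  ring

theorem fderiv_LKC (i : Fin N) (hbi : b i = 0) (hx : ∀ l, x.1 l ≠ 0) (hq : qq N x ≠ 0) :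
    fderiv ℝ (LKC N κ k b i) x v =
      ((1 + κ * qq N x) * x.2 i - 2 * κ * qp N x * x.1 i)
          * (∑ l, (v.1 l * x.2 l + x.1 l * v.2 l))
        + (2 * κ * qp N x * x.2 i - k * x.1 i / √(qq N x) ^ 3) * (∑ l, x.1 l * v.1 l)
        - 2 * x.1 i * ∑ l, x.2 l * v.2 l
        + 2 * x.1 i * ∑ l, b l / (x.1 l) ^ 3 * v.1 l
        + qp N x * (1 + κ * qq N x) * v.2 i
        + (k / √(qq N x) - (pp N x + κ * qp N x ^ 2) - centrifugal b x) * v.1 i := by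
  have hB := differentiableAt_centrifugal b hx
  have hR := differentiableAt_inv_sqrt_qq hq
  have h1 := (differentiable_qq (N := N)).differentiableAt (x := x)
  have h2 := (differentiable_pp (N := N)).differentiableAt (x := x)
  have h3 := (differentiable_qp (N := N)).differentiableAt (x := x)
  rw [LKC_eq N κ k b i hbi]
  simp only [div_eq_mul_inv (k * _)]
  refine fderiv_apply_of_hasDerivAt_line (by fun_prop) ?_
  have hA := ((hasDerivAt_line_qq x v).const_mul κ).const_add 1
  have hqi := hasDerivAt_line_fst x v i
  refine HasDerivAt.congr_deriv
      ((((((hasDerivAt_line_qp x v).fun_mul hA).fun_mul (hasDerivAt_line_snd x v i)).fun_sub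
    (hqi.fun_mul ((hasDerivAt_line_pp x v).fun_add
      (((hasDerivAt_line_qp x v).fun_pow 2).const_mul κ)))).fun_add
    ((hqi.const_mul k).fun_mul (hasDerivAt_line_inv_sqrt_qq x v hq))).fun_sub
    (hqi.fun_mul (hasDerivAt_line_centrifugal x v b hx))) ?_
  simp only [zero_smul, add_zero]
  push_cast
  ring

end Gradients

/-- Contraction of two linear combinations of the vectors `q`, `p`, `c` and a basis vector. -/
theorem sum_linear_combination_mul {N : ℕ} (q p c : Fin N → ℝ) (i : Fin N)
    (a₁ a₂ a₃ a₄ h₁ h₂ h₄ : ℝ) :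
    ∑ j, (a₁ * q j + a₂ * p j + a₃ * c j + a₄ * (Pi.single j 1 : Fin N → ℝ) i)
        * (h₁ * q j + h₂ * p j + h₄ * (Pi.single j 1 : Fin N → ℝ) i)
      = a₁ * h₁ * ∑ j, q j ^ 2 + (a₁ * h₂ + a₂ * h₁) * ∑ j, q j * p j
        + a₂ * h₂ * ∑ j, p j ^ 2 + a₃ * h₁ * ∑ j, c j * q j + a₃ * h₂ * ∑ j, c j * p j
        + (a₄ * (h₁ * q i + h₂ * p i + h₄) + h₄ * (a₁ * q i + a₂ * p i + a₃ * c i)) := by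
  have h : a₄ * (h₁ * q i + h₂ * p i + h₄) + h₄ * (a₁ * q i + a₂ * p i + a₃ * c i)
      = ∑ j, (a₄ * (h₁ * q j + h₂ * p j + h₄) + h₄ * (a₁ * q j + a₂ * p j + a₃ * c j))
          * (Pi.single j 1 : Fin N → ℝ) i := by
    simp [Pi.single_apply]
  rw [h]
  simp only [Finset.mul_sum, ← Finset.sum_add_distrib]
  refine Finset.sum_congr rfl fun j _ => ?_
  have hs : (Pi.single j 1 : Fin N → ℝ) i ^ 2 = (Pi.single j 1 : Fin N → ℝ) i := by
    simp [Pi.single_apply]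
  linear_combination a₄ * h₄ * hs

/-- if `b_i = 0`, then `{L_i^B, H^B} = 0` on the open set where
every `q_l ≠ 0`, `𝐪² ≠ 0` and `1 + κ𝐪² > 0`. -/
theorem LRL_commutes_with_HKC (N : ℕ) (hN : 2 ≤ N) (κ k : ℝ)
    (b : Fin N → ℝ) (i : Fin N) (hbi : b i = 0)
    (x : Phase N) (hx : ∀ l, x.1 l ≠ 0) (hq : qq N x ≠ 0)
    (hκ : 1 + κ * qq N x > 0) :
    pb (LKC N κ k b i) (HKC N κ k b) x = 0 := by
  have h0 : 0 ≤ qq N x := Finset.sum_nonneg fun l _ => sq_nonneg _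
  have hr : √(qq N x) ≠ 0 := (Real.sqrt_pos.mpr (lt_of_le_of_ne h0 hq.symm)).ne'
  have hr2 : √(qq N x) ^ 2 = qq N x := Real.sq_sqrt h0
  have hcq : ∑ j, b j / (x.1 j) ^ 3 * x.1 j = centrifugal b x :=
    Finset.sum_congr rfl fun j _ => by
      have := hx j
      field_simp
  have hq2 : ∑ j, x.1 j ^ 2 = qq N x := rfl
  have hp2 : ∑ j, x.2 j ^ 2 = pp N x := rfl
  have hqp : ∑ j, x.1 j * x.2 j = qp N x := rfl
  have key := sum_linear_combination_mul x.1 x.2 (fun j => b j / (x.1 j) ^ 3) i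
  have e₁ := key
    (2 * κ * qp N x * x.2 i - k * x.1 i / √(qq N x) ^ 3)
    ((1 + κ * qq N x) * x.2 i - 2 * κ * qp N x * x.1 i)
    (2 * x.1 i)
    (k / √(qq N x) - (pp N x + κ * qp N x ^ 2) - centrifugal b x)
    ((1 + κ * qq N x) * κ * qp N x) (1 + κ * qq N x) 0
  have e₂ := key
    (κ * (pp N x + κ * qp N x ^ 2 + centrifugal b x) + k / √(qq N x) ^ 3)
    ((1 + κ * qq N x) * κ * qp N x)
    (-(1 + κ * qq N x)) 0
    ((1 + κ * qq N x) * x.2 i - 2 * κ * qp N x * x.1 i) (-(2 * x.1 i))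
    (qp N x * (1 + κ * qq N x))
  rw [hq2, hp2, hqp, hcq] at e₁ e₂
  have h₁₂ := congrArg₂ (· - ·) e₁ e₂
  simp only [← Finset.sum_sub_distrib] at h₁₂
  refine Eq.trans (Finset.sum_congr rfl fun j _ => ?_) (h₁₂.trans ?_)
  · simp only [fderiv_LKC κ k b x _ i hbi hx hq, fderiv_HKC κ k b x _ hx hq]
    simp [Pi.single_apply]
    ring
  rw [hbi]
  field_simp
  generalize √(qq N x) = r at *
  rw [← hr2]
  ring
end
end
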